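/- Let p ≥ 5 and q ≥ 5 be integers. For every k ≥ 1 the following four word identities hold: (0)·B_{4k−3}·W̄_k′ = W̄_k·Ū_k; B_{4k−2} = W̄_k′·Ū_k^{p−4}·(0); (0)·B_{4k−1}·W̄_{k+1}′ = Ū_{k+1}; and B_{4k} = W̄_{k+1}′·(0). Here W̄_k′ denotes the word W̄_k with its first letter (which is a 0) removed. -/

import Mathlib

/-- `a`-fold concatenation of a word. -/
def wpow (X : List ℕ) (a : ℕ) : List ℕ := (List.replicate a X).flatten

/-- For `p ≥ 5`, `q ≥ 5`: `UWbar p q k = (Ū_{k+1}, W̄_{k+1})`, where `Ū_1 = (1)`, `W̄_1 = (0)`,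
`Ū_{k+1} = W̄_k Ū_k^{p−4} (W̄_k Ū_k^{p−3})^{q−3}` and `W̄_{k+1} = W̄_k Ū_k^{p−4} (W̄_k Ū_k^{p−3})^{q−4}`. -/
def UWbar (p q : ℕ) : ℕ → List ℕ × List ℕ
  | 0 => ([1], [0])
  | k + 1 =>
      ((UWbar p q k).2 ++ wpow (UWbar p q k).1 (p - 4) ++
        wpow ((UWbar p q k).2 ++ wpow (UWbar p q k).1 (p - 3)) (q - 3),
       (UWbar p q k).2 ++ wpow (UWbar p q k).1 (p - 4) ++
        wpow ((UWbar p q k).2 ++ wpow (UWbar p q k).1 (p - 3)) (q - 4))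

/-- Shallit's words for the continued fraction `[q−3; 1, p−4, 1, q−4, 1, p−4, 1, q−4, …]` of `β`,
packaged in quadruples: `BQuad p q k = (B_{4k+1}, B_{4k+2}, B_{4k+3}, B_{4k+4})`.
Here `B_1 = (1)`, `B_2 = (1)^{p−4}(0)`, `B_3 = B_2 B_1`, `B_4 = B_3^{q−4} B_2`, and for `k ≥ 1`:
`B_{4k+1} = B_{4k} B_{4k−1}`, `B_{4k+2} = B_{4k+1}^{p−4} B_{4k}`, `B_{4k+3} = B_{4k+2} B_{4k+1}`,
`B_{4k+4} = B_{4k+3}^{q−4} B_{4k+2}`. -/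
def BQuad (p q : ℕ) : ℕ → List ℕ × List ℕ × List ℕ × List ℕ
  | 0 =>
      let B1 : List ℕ := [1]
      let B2 : List ℕ := wpow [1] (p - 4) ++ [0]
      let B3 : List ℕ := B2 ++ B1
      let B4 : List ℕ := wpow B3 (q - 4) ++ B2
      (B1, B2, B3, B4)
  | k + 1 =>
      let Q := BQuad p q k
      let B1 : List ℕ := Q.2.2.2 ++ Q.2.2.1
      let B2 : List ℕ := wpow B1 (p - 4) ++ Q.2.2.2
      let B3 : List ℕ := B2 ++ B1
      let B4 : List ℕ := wpow B3 (q - 4) ++ B2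
      (B1, B2, B3, B4)

theorem wpow_zero' (X : List ℕ) : wpow X 0 = [] := by simp [wpow]

theorem wpow_succ' (X : List ℕ) (a : ℕ) : wpow X (a + 1) = X ++ wpow X a := by
  simp [wpow, List.replicate_succ]

theorem wpow_conj (B w U : List ℕ) (h : B ++ w = w ++ U) (n : ℕ) :
    wpow B n ++ w = w ++ wpow U n := by
  induction n with
  | zero => simp [wpow_zero']
  | succ n ih =>
    rw [wpow_succ', wpow_succ', List.append_assoc, ih, ← List.append_assoc, h, List.append_assoc]

theorem step_core (B1 w U : List ℕ) (a b : ℕ) (h : B1 ++ w = w ++ U) :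
    wpow (w ++ wpow U a ++ [0] ++ B1) b ++ (w ++ wpow U a ++ [0]) =
      w ++ wpow U a ++ wpow ([0] ++ w ++ wpow U (a + 1)) b ++ [0] ∧
    [0] ++ (w ++ wpow U a ++ [0] ++ B1) ++
        (w ++ wpow U a ++ wpow ([0] ++ w ++ wpow U (a + 1)) b) =
      [0] ++ w ++ wpow U a ++ wpow ([0] ++ w ++ wpow U (a + 1)) (b + 1) := by
  have h2 : B1 ++ (w ++ wpow U a) = w ++ wpow U (a + 1) := by
    rw [wpow_succ', ← List.append_assoc, h, List.append_assoc]
  constructor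
  · have h3 := wpow_conj (w ++ wpow U a ++ [0] ++ B1) (w ++ wpow U a)
      ([0] ++ w ++ wpow U (a + 1)) (by
        rw [List.append_assoc _ B1, h2]; simp) b
    rw [← List.append_assoc _ _ [0], h3]
  · rw [wpow_succ' _ b, ← List.append_assoc _ _ (wpow _ b), ← List.append_assoc _ _ (wpow _ b)]
    congr 1
    rw [← List.append_assoc [0] _ B1, List.append_assoc _ B1, h2]
    simp

theorem level_step (a b k : ℕ) (w : List ℕ)
    (hw : (UWbar (a + 4) (b + 4) k).2 = 0 :: w)
    (h1 : (BQuad (a + 4) (b + 4) k).1 ++ w = w ++ (UWbar (a + 4) (b + 4) k).1)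
    (h2 : (BQuad (a + 4) (b + 4) k).2.1 = w ++ wpow (UWbar (a + 4) (b + 4) k).1 a ++ [0]) :
    ∃ w', (UWbar (a + 4) (b + 4) (k + 1)).2 = 0 :: w' ∧
      [0] ++ (BQuad (a + 4) (b + 4) k).2.2.1 ++ w' = (UWbar (a + 4) (b + 4) (k + 1)).1 ∧
      (BQuad (a + 4) (b + 4) k).2.2.2 = w' ++ [0] := by
  have h3 : (BQuad (a + 4) (b + 4) k).2.2.1 =
      (BQuad (a + 4) (b + 4) k).2.1 ++ (BQuad (a + 4) (b + 4) k).1 := by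
    cases k <;> rfl
  have h4 : (BQuad (a + 4) (b + 4) k).2.2.2 =
      wpow (BQuad (a + 4) (b + 4) k).2.2.1 b ++ (BQuad (a + 4) (b + 4) k).2.1 := by
    cases k <;> rfl
  have hU : (UWbar (a + 4) (b + 4) (k + 1)).1 = (UWbar (a + 4) (b + 4) k).2 ++
      wpow (UWbar (a + 4) (b + 4) k).1 a ++ wpow ((UWbar (a + 4) (b + 4) k).2 ++
        wpow (UWbar (a + 4) (b + 4) k).1 (a + 1)) (b + 1) := rfl
  have hW : (UWbar (a + 4) (b + 4) (k + 1)).2 = (UWbar (a + 4) (b + 4) k).2 ++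
      wpow (UWbar (a + 4) (b + 4) k).1 a ++ wpow ((UWbar (a + 4) (b + 4) k).2 ++
        wpow (UWbar (a + 4) (b + 4) k).1 (a + 1)) b := rfl
  obtain ⟨c1, c2⟩ := step_core _ w _ a b h1
  rw [h4, h3, h2, hU, hW, hw]
  exact ⟨_, rfl, c2, c1⟩

theorem level_inv (a b k : ℕ) :
    ∃ w, (UWbar (a + 4) (b + 4) k).2 = 0 :: w ∧
      (BQuad (a + 4) (b + 4) k).1 ++ w = w ++ (UWbar (a + 4) (b + 4) k).1 ∧
      (BQuad (a + 4) (b + 4) k).2.1 = w ++ wpow (UWbar (a + 4) (b + 4) k).1 a ++ [0] := by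
  induction k with
  | zero => exact ⟨[], rfl, rfl, rfl⟩
  | succ k ih =>
    obtain ⟨w, hw, h1, h2⟩ := ih
    obtain ⟨w', hw', h3, h4⟩ := level_step a b k w hw h1 h2
    have e1 : (BQuad (a + 4) (b + 4) (k + 1)).1 =
      (BQuad (a + 4) (b + 4) k).2.2.2 ++ (BQuad (a + 4) (b + 4) k).2.2.1 := rfl
    have e2 : (BQuad (a + 4) (b + 4) (k + 1)).2.1 =
      wpow (BQuad (a + 4) (b + 4) (k + 1)).1 a ++ (BQuad (a + 4) (b + 4) k).2.2.2 := rfl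
    have g1 : (BQuad (a + 4) (b + 4) (k + 1)).1 ++ w' =
        w' ++ (UWbar (a + 4) (b + 4) (k + 1)).1 := by
      rw [e1, h4, ← h3]; simp
    refine ⟨w', hw', g1, ?_⟩
    rw [e2, h4, ← List.append_assoc, wpow_conj _ _ _ g1]

/-- For `p ≥ 5`, `q ≥ 5` and every `k ≥ 1`:
`(0)·B_{4k−3}·W̄_k′ = W̄_k·Ū_k`, `B_{4k−2} = W̄_k′·Ū_k^{p−4}·(0)`,
`(0)·B_{4k−1}·W̄_{k+1}′ = Ū_{k+1}`, and `B_{4k} = W̄_{k+1}′·(0)`,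
where `W̄_k′` is `W̄_k` with its first letter (a `0`) removed. -/
theorem shallit_words (p q : ℕ) (hp : 5 ≤ p) (hq : 5 ≤ q) (k : ℕ) (hk : 1 ≤ k) :
    ([0] ++ (BQuad p q (k - 1)).1 ++ ((UWbar p q (k - 1)).2).tail =
        (UWbar p q (k - 1)).2 ++ (UWbar p q (k - 1)).1) ∧
    ((BQuad p q (k - 1)).2.1 =
        ((UWbar p q (k - 1)).2).tail ++ wpow (UWbar p q (k - 1)).1 (p - 4) ++ [0]) ∧
    ([0] ++ (BQuad p q (k - 1)).2.2.1 ++ ((UWbar p q k).2).tail = (UWbar p q k).1) ∧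
    ((BQuad p q (k - 1)).2.2.2 = ((UWbar p q k).2).tail ++ [0]) := by
  obtain ⟨a, rfl⟩ : ∃ a, p = a + 4 := ⟨p - 4, by omega⟩
  obtain ⟨b, rfl⟩ : ∃ b, q = b + 4 := ⟨q - 4, by omega⟩
  obtain ⟨k, rfl⟩ : ∃ j, k = j + 1 := ⟨k - 1, by omega⟩
  obtain ⟨w, hw, h1, h2⟩ := level_inv a b k
  obtain ⟨w', hw', h3, h4⟩ := level_step a b k w hw h1 h2
  simp only [Nat.add_sub_cancel]
  rw [hw, hw']
  refine ⟨?_, h2, h3, h4⟩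
  rw [List.append_assoc, List.tail_cons, h1]; rfl
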